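/- arXiv:2605.28892 — 9 statements merged into one kernel-verified Lean document; each statement's English description precedes it below -/
import Mathlib

section
/- The family Λ satisfies the Chapman–Kolmogorov semigroup law Λ(τ₁+τ₂) = Λ(τ₁) · Λ(τ₂) for all τ₁, τ₂ ≥ 0 if and only if k + r = 1 or (k = 1 and r = 1). In particular, for k + r > 1 with (k,r) ≠ (1,1), Λ fails the Chapman–Kolmogorov matrix equation even though the process is classically P-divisible. -/
/-- Transition matrix of the Funessian process. -/
noncomputable def Lam (k r α τ : ℝ) : Matrix (Fin 2) (Fin 2) ℝ :=
  !![k + (1 - k) * Real.exp (-α * τ), (1 - r) * (1 - Real.exp (-α * τ));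
     (1 - k) * (1 - Real.exp (-α * τ)), r + (1 - r) * Real.exp (-α * τ)]

/-- The failure of the Chapman–Kolmogorov law for `Lam` is a multiple of a fixed matrix. -/
theorem Lam_mul_sub_Lam_add (k r α τ₁ τ₂ : ℝ) :
    Lam k r α τ₁ * Lam k r α τ₂ - Lam k r α (τ₁ + τ₂) =
      ((1 - k - r) * (1 - Real.exp (-α * τ₁)) * (1 - Real.exp (-α * τ₂))) •
        !![1 - k, -(1 - r); -(1 - k), 1 - r] := by
  simp only [Lam, mul_add (-α), Real.exp_add]
  ext i j
  fin_cases i <;> fin_cases j <;> simp <;> ring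

/-- The Chapman–Kolmogorov law for `Lam` holds iff `k + r = 1` or `k = r = 1`. -/
theorem forall_Lam_add_iff (k r : ℝ) {α : ℝ} (hα : 0 < α) :
    (∀ τ₁ τ₂ : ℝ, 0 ≤ τ₁ → 0 ≤ τ₂ →
        Lam k r α (τ₁ + τ₂) = Lam k r α τ₁ * Lam k r α τ₂) ↔
      (k + r = 1 ∨ (k = 1 ∧ r = 1)) := by
  constructor
  · intro h
    have hexp : 1 - Real.exp (-α * 1) ≠ 0 :=
      (sub_pos.2 (Real.exp_lt_one_iff.2 (by linarith))).ne'
    have hzero := Lam_mul_sub_Lam_add k r α 1 1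
    rw [← h 1 1 zero_le_one zero_le_one, sub_self, eq_comm, smul_eq_zero] at hzero
    rcases hzero with hc | hQ
    · left
      have : 1 - k - r = 0 := by simpa only [mul_eq_zero, hexp, or_false] using hc
      linarith
    · right
      have h₀ : 1 - k = 0 := congrFun (congrFun hQ 0) 0
      have h₁ : 1 - r = 0 := congrFun (congrFun hQ 1) 1
      constructor <;> linarith
  · intro h τ₁ τ₂ _ _
    refine (sub_eq_zero.1 ((Lam_mul_sub_Lam_add k r α τ₁ τ₂).trans (smul_eq_zero.2 ?_))).symm
    rcases h with h | ⟨rfl, rfl⟩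
    · left
      rw [show 1 - k - r = 0 by linarith, zero_mul, zero_mul]
    · right
      ext i j
      fin_cases i <;> fin_cases j <;> simp

/-- The family `Λ` satisfies the Chapman–Kolmogorov semigroup law iff
`k + r = 1` or `k = r = 1`; in particular for `k + r > 1` with `(k,r) ≠ (1,1)`
the Chapman–Kolmogorov matrix equation fails. -/
theorem Lam_semigroup_iff (k r α : ℝ) (hk0 : 0 ≤ k) (hk1 : k ≤ 1)
    (hr0 : 0 ≤ r) (hr1 : r ≤ 1) (hα : 0 < α) :
    ((∀ τ₁ τ₂ : ℝ, 0 ≤ τ₁ → 0 ≤ τ₂ →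
        Lam k r α (τ₁ + τ₂) = Lam k r α τ₁ * Lam k r α τ₂) ↔
      (k + r = 1 ∨ (k = 1 ∧ r = 1))) ∧
    (1 < k + r → ¬(k = 1 ∧ r = 1) →
      ¬(∀ τ₁ τ₂ : ℝ, 0 ≤ τ₁ → 0 ≤ τ₂ →
          Lam k r α (τ₁ + τ₂) = Lam k r α τ₁ * Lam k r α τ₂)) := by
  refine ⟨forall_Lam_add_iff k r hα, fun hkr hne h => ?_⟩
  rcases (forall_Lam_add_iff k r hα).1 h with h₁ | h₁
  · exact hkr.ne' h₁
  · exact hne h₁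
end

section
/- For every fixed x₀ ∈ E with P(X_{t₁}=x₁, X_{t₀}=x₀) > 0 for all x₁, the one-point memory transition matrices satisfy the composition law Q^{(x₀)}(t₃|t₁) = Q^{(x₀)}(t₃|t₂) · Q^{(x₀)}(t₂|t₁), i.e., for all x₃, x₁ ∈ E: P(X_{t₃}=x₃ | X_{t₁}=x₁, X_{t₀}=x₀) = Σ_{x₂∈E} P(X_{t₃}=x₃ | X_{t₂}=x₂, X_{t₀}=x₀) · P(X_{t₂}=x₂ | X_{t₁}=x₁, X_{t₀}=x₀). -/
open Finset

/-- Joint probability `P(X_{t₂}=x₂, X_{t₁}=x₁, X_{t₀}=x₀)`. -/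
noncomputable def m210 {E : Type*} [Fintype E] (p : E → E → E → E → ℝ)
    (x2 x1 x0 : E) : ℝ := ∑ x3, p x3 x2 x1 x0

/-- Joint probability `P(X_{t₁}=x₁, X_{t₀}=x₀)`. -/
noncomputable def m10 {E : Type*} [Fintype E] (p : E → E → E → E → ℝ)
    (x1 x0 : E) : ℝ := ∑ x3, ∑ x2, p x3 x2 x1 x0

/-- Joint probability `P(X_{t₂}=x₂, X_{t₀}=x₀)`. -/
noncomputable def m20 {E : Type*} [Fintype E] (p : E → E → E → E → ℝ)
    (x2 x0 : E) : ℝ := ∑ x3, ∑ x1, p x3 x2 x1 x0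

/-- Joint probability `P(X_{t₃}=x₃, X_{t₁}=x₁, X_{t₀}=x₀)`. -/
noncomputable def m310 {E : Type*} [Fintype E] (p : E → E → E → E → ℝ)
    (x3 x1 x0 : E) : ℝ := ∑ x2, p x3 x2 x1 x0

/-- Joint probability `P(X_{t₃}=x₃, X_{t₂}=x₂, X_{t₀}=x₀)`. -/
noncomputable def m320 {E : Type*} [Fintype E] (p : E → E → E → E → ℝ)
    (x3 x2 x0 : E) : ℝ := ∑ x1, p x3 x2 x1 x0

/-- Conditional probability `P(X_{t₃}=x₃ | X_{t₂}=x₂, X_{t₀}=x₀)`, the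
`(x₃,x₂)` entry of the one-point memory transition matrix `Q^{(x₀)}(t₃|t₂)`. -/
noncomputable def C32 {E : Type*} [Fintype E] (p : E → E → E → E → ℝ)
    (x3 x2 x0 : E) : ℝ := m320 p x3 x2 x0 / m20 p x2 x0

/-- Conditional probability `P(X_{t₃}=x₃ | X_{t₁}=x₁, X_{t₀}=x₀)`, the
`(x₃,x₁)` entry of the one-point memory transition matrix `Q^{(x₀)}(t₃|t₁)`. -/
noncomputable def C31 {E : Type*} [Fintype E] (p : E → E → E → E → ℝ)
    (x3 x1 x0 : E) : ℝ := m310 p x3 x1 x0 / m10 p x1 x0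

/-- Conditional probability `P(X_{t₂}=x₂ | X_{t₁}=x₁, X_{t₀}=x₀)`, the
`(x₂,x₁)` entry of the one-point memory transition matrix `Q^{(x₀)}(t₂|t₁)`. -/
noncomputable def C21 {E : Type*} [Fintype E] (p : E → E → E → E → ℝ)
    (x2 x1 x0 : E) : ℝ := m210 p x2 x1 x0 / m10 p x1 x0

/-- Under the one-point-memory property, the one-point memory transition
matrices satisfy the Chapman–Kolmogorov-type composition law
`Q^{(x₀)}(t₃|t₁) = Q^{(x₀)}(t₃|t₂) · Q^{(x₀)}(t₂|t₁)`. -/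
theorem onePointMemory_CK {E : Type*} [Fintype E] [Nonempty E]
    (p : E → E → E → E → ℝ)
    (hnn : ∀ x3 x2 x1 x0, 0 ≤ p x3 x2 x1 x0)
    (hsum : ∑ x3, ∑ x2, ∑ x1, ∑ x0, p x3 x2 x1 x0 = 1)
    (h210 : ∀ x2 x1 x0, 0 < m210 p x2 x1 x0)
    (h20 : ∀ x2 x0, 0 < m20 p x2 x0)
    (hmem : ∀ x3 x2 x1 x0, p x3 x2 x1 x0 / m210 p x2 x1 x0 = C32 p x3 x2 x0)
    (x0 : E) (h10 : ∀ x1, 0 < m10 p x1 x0) :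
    ∀ x3 x1, C31 p x3 x1 x0 = ∑ x2, C32 p x3 x2 x0 * C21 p x2 x1 x0 := by
  intro x3 x1
  rw [C31, m310, Finset.sum_div]
  refine Finset.sum_congr rfl fun x2 _ => ?_
  rw [← hmem x3 x2 x1 x0, C21, div_mul_div_cancel₀ (h210 x2 x1 x0).ne']
end

section
/- Assume k + r ≥ 1. The map τ ↦ Λ(τ) is differentiable on (0,∞) and satisfies the master equation (differential Chapman–Kolmogorov equation) Λ'(τ) = w(τ) · L · Λ(τ), where w(τ) = α·e^{−ατ}/det(Λ(τ)) and L = [[−(1−k), 1−r], [1−k, −(1−r)]]; moreover w(τ) ≥ 0 for all τ ≥ 0, and if k + r = 1 then w(τ) = α for all τ ≥ 0. -/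
/-- The constant generator matrix `L`. -/
noncomputable def genL (k r : ℝ) : Matrix (Fin 2) (Fin 2) ℝ :=
  !![-(1 - k), 1 - r; 1 - k, -(1 - r)]

/-- The time-dependent rate `w(τ) = α e^{−ατ} / det Λ(τ)`. -/
noncomputable def wRate (k r α τ : ℝ) : ℝ :=
  α * Real.exp (-α * τ) / (Lam k r α τ).det

theorem Lam_det (k r α τ : ℝ) :
    (Lam k r α τ).det = (k + r - 1) + (2 - k - r) * Real.exp (-α * τ) := by
  simp only [Lam, Matrix.det_fin_two_of]
  ring

theorem genL_mul_Lam (k r α τ : ℝ) :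
    genL k r * Lam k r α τ = (Lam k r α τ).det • genL k r := by
  rw [Lam_det]
  ext i j
  fin_cases i <;> fin_cases j <;> simp [genL, Lam, Matrix.mul_apply, Fin.sum_univ_two] <;> ring

theorem Lam_det_pos {k r α τ : ℝ} (hα : 0 ≤ α) (hτ : 0 ≤ τ)
    (hkr : 1 ≤ k + r) : 0 < (Lam k r α τ).det := by
  rw [Lam_det]
  have hpos := Real.exp_pos (-α * τ)
  have hle : Real.exp (-α * τ) ≤ 1 := Real.exp_le_one_iff.mpr (by nlinarith)
  nlinarith [mul_nonneg (sub_nonneg.mpr hkr) (sub_nonneg.mpr hle)]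

theorem hasDerivAt_Lam_apply (k r α τ : ℝ) (i j : Fin 2) :
    HasDerivAt (fun t => Lam k r α t i j) (α * Real.exp (-α * τ) * genL k r i j) τ := by
  have he : HasDerivAt (fun t => Real.exp (-α * t)) (Real.exp (-α * τ) * (-α * 1)) τ :=
    ((hasDerivAt_id τ).const_mul (-α)).exp
  fin_cases i <;> fin_cases j
  · exact ((he.const_mul (1 - k)).const_add k).congr_deriv (by simp [genL]; ring)
  · exact ((he.const_sub 1).const_mul (1 - r)).congr_deriv (by simp [genL]; ring)
  · exact ((he.const_sub 1).const_mul (1 - k)).congr_deriv (by simp [genL]; ring)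
  · exact ((he.const_mul (1 - r)).const_add r).congr_deriv (by simp [genL]; ring)

/-- For `k + r ≥ 1`, the map `τ ↦ Λ(τ)` is differentiable on `(0,∞)` and
satisfies the master equation `Λ'(τ) = w(τ) · L · Λ(τ)` (entrywise); moreover
`w(τ) ≥ 0` for all `τ ≥ 0`, and `w ≡ α` in the Markovian case `k + r = 1`. -/
theorem Funessian_master_equation (k r α : ℝ) (hk0 : 0 ≤ k) (hk1 : k ≤ 1)
    (hr0 : 0 ≤ r) (hr1 : r ≤ 1) (hα : 0 < α) (hkr : 1 ≤ k + r) :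
    (∀ τ : ℝ, 0 < τ → ∀ i j : Fin 2,
      HasDerivAt (fun t => Lam k r α t i j)
        (wRate k r α τ * ((genL k r * Lam k r α τ) i j)) τ) ∧
    (∀ τ : ℝ, 0 ≤ τ → 0 ≤ wRate k r α τ) ∧
    (k + r = 1 → ∀ τ : ℝ, 0 ≤ τ → wRate k r α τ = α) := by
  refine ⟨fun τ hτ i j => ?_, fun τ hτ => ?_, fun h τ _ => ?_⟩
  · have hdet := (Lam_det_pos hα.le hτ.le hkr).ne'
    refine (hasDerivAt_Lam_apply k r α τ i j).congr_deriv ?_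
    rw [genL_mul_Lam, Matrix.smul_apply, smul_eq_mul, wRate, ← mul_assoc, div_mul_cancel₀ _ hdet]
  · exact div_nonneg (by positivity) (Lam_det_pos hα.le hτ hkr).le
  · have hdet : (Lam k r α τ).det = Real.exp (-α * τ) := by
      rw [Lam_det]
      linear_combination (1 - Real.exp (-α * τ)) * h
    rw [wRate, hdet, mul_div_cancel_right₀ _ (Real.exp_ne_zero _)]
end

section
/- Let x₁, x₂ be real numbers. The conditional mean x₁·Λ(τ)_{1,j₀} + x₂·Λ(τ)_{2,j₀} converges as τ → ∞ to k·x₁ + (1−k)·x₂ when j₀ = 1, and to (1−r)·x₁ + r·x₂ when j₀ = 2; thus the stationary conditional mean of the Funessian process retains dependence on the initial state whenever k + r > 1. -/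
open Filter

/-- The stationary conditional mean of the Funessian process: the conditional
mean converges as `τ → ∞` to `k·x₁ + (1−k)·x₂` for initial state `x₁` and to
`(1−r)·x₁ + r·x₂` for initial state `x₂`, hence retains dependence on the
initial state. -/
theorem stationary_conditional_mean (k r α : ℝ) (hk0 : 0 ≤ k) (hk1 : k ≤ 1)
    (hr0 : 0 ≤ r) (hr1 : r ≤ 1) (hα : 0 < α) (x₁ x₂ : ℝ) (j₀ : Fin 2) :
    Tendsto (fun τ => x₁ * Lam k r α τ 0 j₀ + x₂ * Lam k r α τ 1 j₀) atTop
      (nhds (if j₀ = 0 then k * x₁ + (1 - k) * x₂ else (1 - r) * x₁ + r * x₂)) := by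
  have hexp : Tendsto (fun τ : ℝ => Real.exp (-α * τ)) atTop (nhds 0) :=
    Real.tendsto_exp_atBot.comp (tendsto_id.const_mul_atTop_of_neg (neg_neg_of_pos hα))
  have hone : Tendsto (fun τ : ℝ => 1 - Real.exp (-α * τ)) atTop (nhds 1) := by
    simpa using hexp.const_sub 1
  fin_cases j₀
  · have h := (((hexp.const_mul (1 - k)).const_add k).const_mul x₁).add
      ((hone.const_mul (1 - k)).const_mul x₂)
    simpa [Lam, mul_comm] using h
  · have h := ((hone.const_mul (1 - r)).const_mul x₁).add
      (((hexp.const_mul (1 - r)).const_add r).const_mul x₂)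
    simpa [Lam, mul_comm] using h
end

section
/- Let x₁, x₂ be real numbers, let j₀ ∈ {1,2}, write Q^{(1)} = Q¹ and Q^{(2)} = Q², and fix τ ≥ 0. Then the stationary two-time correlation, lim_{σ→∞} [ Σ_{j,k∈{1,2}} x_j·x_k·Q^{(j₀)}(τ)_{j,k}·Λ(σ)_{k,j₀} − (Σ_j x_j·Λ(σ+τ)_{j,j₀})·(Σ_k x_k·Λ(σ)_{k,j₀}) ], exists and equals (x₁−x₂)²·(k(1−k) if j₀=1, r(1−r) if j₀=2)·e^{−ατ}; in particular it decays exponentially in the time difference τ. -/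
open Filter

/-- One-point memory transition matrix conditioned on initial state `x₁`. -/
noncomputable def Qone (k α τ : ℝ) : Matrix (Fin 2) (Fin 2) ℝ :=
  !![k + (1 - k) * Real.exp (-α * τ), k * (1 - Real.exp (-α * τ));
     (1 - k) * (1 - Real.exp (-α * τ)), (1 - k) + k * Real.exp (-α * τ)]

/-- One-point memory transition matrix conditioned on initial state `x₂`. -/
noncomputable def Qtwo (r α τ : ℝ) : Matrix (Fin 2) (Fin 2) ℝ :=
  !![(1 - r) + r * Real.exp (-α * τ), (1 - r) * (1 - Real.exp (-α * τ));
     r * (1 - Real.exp (-α * τ)), r + (1 - r) * Real.exp (-α * τ)]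

/-- `Q^{(j₀)}` : `Q¹` for `j₀ = 0` and `Q²` for `j₀ = 1`. -/
noncomputable def Qmem (k r α : ℝ) (j₀ : Fin 2) (τ : ℝ) : Matrix (Fin 2) (Fin 2) ℝ :=
  if j₀ = 0 then Qone k α τ else Qtwo r α τ

/-- The stationary two-time correlation of the Funessian process exists and
decays exponentially in the time difference `τ`. -/
theorem stationary_correlation (k r α : ℝ) (hk0 : 0 ≤ k) (hk1 : k ≤ 1)
    (hr0 : 0 ≤ r) (hr1 : r ≤ 1) (hα : 0 < α) (x₁ x₂ : ℝ) (j₀ : Fin 2)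
    (τ : ℝ) (hτ : 0 ≤ τ) :
    Tendsto (fun σ =>
        (∑ j : Fin 2, ∑ l : Fin 2,
            ![x₁, x₂] j * ![x₁, x₂] l * Qmem k r α j₀ τ j l * Lam k r α σ l j₀) -
          (∑ j : Fin 2, ![x₁, x₂] j * Lam k r α (σ + τ) j j₀) *
            (∑ l : Fin 2, ![x₁, x₂] l * Lam k r α σ l j₀)) atTop
      (nhds ((x₁ - x₂) ^ 2 * (if j₀ = 0 then k * (1 - k) else r * (1 - r)) *
        Real.exp (-α * τ))) := by
  have hu : Tendsto (fun σ : ℝ => Real.exp (-α * σ)) atTop (nhds 0) :=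
    Real.tendsto_exp_atBot.comp (tendsto_id.const_mul_atTop_of_neg (neg_neg_of_pos hα))
  have hexp (σ : ℝ) : Real.exp (-α * (σ + τ)) = Real.exp (-α * σ) * Real.exp (-α * τ) := by
    rw [mul_add, Real.exp_add]
  have lim_of_continuous {F : ℝ → ℝ} (hF : Continuous F) :
      Tendsto (fun σ : ℝ => F (Real.exp (-α * σ))) atTop (nhds (F 0)) :=
    (hF.tendsto 0).comp hu
  fin_cases j₀
  · convert lim_of_continuous (F := fun u =>
        (x₁ * x₁ * (k + (1 - k) * Real.exp (-α * τ)) * (k + (1 - k) * u) + x₁ * x₂ * (k * (1 - Real.exp (-α * τ))) * ((1 - k) * (1 - u)) +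
          (x₂ * x₁ * ((1 - k) * (1 - Real.exp (-α * τ))) * (k + (1 - k) * u) + x₂ * x₂ * ((1 - k) + k * Real.exp (-α * τ)) * ((1 - k) * (1 - u)))) -
          (x₁ * (k + (1 - k) * (u * Real.exp (-α * τ))) + x₂ * ((1 - k) * (1 - u * Real.exp (-α * τ)))) *
            (x₁ * (k + (1 - k) * u) + x₂ * ((1 - k) * (1 - u)))) (by fun_prop) using 2
    · simp [Fin.sum_univ_two, Qmem, Qone, Lam, -neg_mul, hexp]
    · simp only [Fin.zero_eta, if_true]
      ring
  · convert lim_of_continuous (F := fun u =>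
        (x₁ * x₁ * ((1 - r) + r * Real.exp (-α * τ)) * ((1 - r) * (1 - u)) + x₁ * x₂ * ((1 - r) * (1 - Real.exp (-α * τ))) * (r + (1 - r) * u) +
          (x₂ * x₁ * (r * (1 - Real.exp (-α * τ))) * ((1 - r) * (1 - u)) + x₂ * x₂ * (r + (1 - r) * Real.exp (-α * τ)) * (r + (1 - r) * u))) -
          (x₁ * ((1 - r) * (1 - u * Real.exp (-α * τ))) + x₂ * (r + (1 - r) * (u * Real.exp (-α * τ)))) *
            (x₁ * ((1 - r) * (1 - u)) + x₂ * (r + (1 - r) * u))) (by fun_prop) using 2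
    · simp [Fin.sum_univ_two, Qmem, Qtwo, Lam, -neg_mul, hexp]
    · simp only [Fin.mk_one, one_ne_zero, if_false]
      ring
end

section
/- Let x₁, x₂ be real numbers, let q₁, q₂ ≥ 0 with q₁ + q₂ = 1, write Q^{(1)} = Q¹ and Q^{(2)} = Q², and fix τ ≥ 0. Then the initial-state-averaged stationary correlation, Σ_{j₀∈{1,2}} q_{j₀} · lim_{σ→∞} [ Σ_{j,k} x_j·x_k·Q^{(j₀)}(τ)_{j,k}·Λ(σ)_{k,j₀} − (Σ_j x_j·Λ(σ+τ)_{j,j₀})·(Σ_k x_k·Λ(σ)_{k,j₀}) ], equals (x₁−x₂)²·(k(1−k)·q₁ + r(1−r)·q₂)·e^{−ατ}; when k + r = 1 this reduces to k·r·(x₁−x₂)²·e^{−ατ}, independent of the initial distribution. -/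
open Filter

/-- The two-time correlation conditioned on the initial state `x_{j₀}`, at
stationary elapsed time `σ` and time difference `τ`. -/
noncomputable def corr (k r α x₁ x₂ : ℝ) (j₀ : Fin 2) (τ σ : ℝ) : ℝ :=
  (∑ j : Fin 2, ∑ l : Fin 2,
      ![x₁, x₂] j * ![x₁, x₂] l * Qmem k r α j₀ τ j l * Lam k r α σ l j₀) -
    (∑ j : Fin 2, ![x₁, x₂] j * Lam k r α (σ + τ) j j₀) *
      (∑ l : Fin 2, ![x₁, x₂] l * Lam k r α σ l j₀)

/-- The conditional two-time correlation converges, as the elapsed time tends to infinity, to the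
variance of the stationary law reached from `x_{j₀}`, damped by `e^{-ατ}`. -/
theorem tendsto_corr (k r : ℝ) {α : ℝ} (hα : 0 < α) (x₁ x₂ : ℝ) (j₀ : Fin 2) (τ : ℝ) :
    Tendsto (corr k r α x₁ x₂ j₀ τ) atTop
      (nhds ((x₁ - x₂) ^ 2 * ![k * (1 - k), r * (1 - r)] j₀ * Real.exp (-α * τ))) := by
  have hexp (s : ℝ) : Tendsto (fun σ => Real.exp (-α * (σ + s))) atTop (nhds 0) :=
    Real.tendsto_exp_atBot.comp
      ((tendsto_atTop_add_const_right atTop s tendsto_id).const_mul_atTop_of_neg (neg_lt_zero.2 hα))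
  have hLam (s : ℝ) (i j : Fin 2) :
      Tendsto (fun σ => Lam k r α (σ + s) i j) atTop
        (nhds (!![k, 1 - r; 1 - k, r] i j)) := by
    have h_affine (a b : ℝ) :
        Tendsto (fun σ => a + b * Real.exp (-α * (σ + s))) atTop (nhds a) := by
      simpa using ((hexp s).const_mul b).const_add a
    have h_scale (a : ℝ) :
        Tendsto (fun σ => a * (1 - Real.exp (-α * (σ + s)))) atTop (nhds a) := by
      simpa using ((hexp s).const_sub 1).const_mul a
    fin_cases i <;> fin_cases j
    exacts [h_affine _ _, h_scale _, h_scale _, h_affine _ _]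
  have hLam_zero (i j : Fin 2) :
      Tendsto (fun σ => Lam k r α σ i j) atTop (nhds (!![k, 1 - r; 1 - k, r] i j)) := by
    simpa only [add_zero] using hLam 0 i j
  have h := (tendsto_finsetSum Finset.univ fun j _ =>
      tendsto_finsetSum Finset.univ fun l _ => (hLam_zero l j₀).const_mul
        (![x₁, x₂] j * ![x₁, x₂] l * Qmem k r α j₀ τ j l)).sub
    ((tendsto_finsetSum Finset.univ fun j _ => (hLam τ j j₀).const_mul (![x₁, x₂] j)).mul
      (tendsto_finsetSum Finset.univ fun l _ => (hLam_zero l j₀).const_mul (![x₁, x₂] l)))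
  refine le_trans h (congrArg nhds ?_).le
  fin_cases j₀ <;> simp [Fin.sum_univ_two, Qmem, Qone, Qtwo] <;> ring

/-- The initial-state-averaged stationary correlation equals
`(x₁−x₂)²·(k(1−k)q₁ + r(1−r)q₂)·e^{−ατ}`; when `k + r = 1` this reduces to
`k·r·(x₁−x₂)²·e^{−ατ}`, independent of the initial distribution. -/
theorem averaged_stationary_correlation (k r α : ℝ) (hk0 : 0 ≤ k) (hk1 : k ≤ 1)
    (hr0 : 0 ≤ r) (hr1 : r ≤ 1) (hα : 0 < α) (x₁ x₂ q₁ q₂ : ℝ)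
    (hq1 : 0 ≤ q₁) (hq2 : 0 ≤ q₂) (hq : q₁ + q₂ = 1) (τ : ℝ) (hτ : 0 ≤ τ) :
    Tendsto (fun σ => ∑ j₀ : Fin 2, ![q₁, q₂] j₀ * corr k r α x₁ x₂ j₀ τ σ) atTop
      (nhds ((x₁ - x₂) ^ 2 * (k * (1 - k) * q₁ + r * (1 - r) * q₂) *
        Real.exp (-α * τ))) ∧
    (k + r = 1 →
      (x₁ - x₂) ^ 2 * (k * (1 - k) * q₁ + r * (1 - r) * q₂) * Real.exp (-α * τ) =
        k * r * (x₁ - x₂) ^ 2 * Real.exp (-α * τ)) := by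
  refine ⟨?_, fun hkr => ?_⟩
  · convert tendsto_finsetSum Finset.univ fun j₀ _ =>
      (tendsto_corr k r hα x₁ x₂ j₀ τ).const_mul (![q₁, q₂] j₀) using 2
    simp [Fin.sum_univ_two]
    ring
  · obtain rfl : r = 1 - k := by linarith
    obtain rfl : q₂ = 1 - q₁ := by linarith
    ring
end

section
/- Assume k + r > 1, let x₁, x₂ be real numbers, let j₀ ∈ {1,2}, and fix τ > 0. If the one-point memory matrix Q^{(j₀)}(τ) is replaced by Γ(τ,σ) in the two-time correlation, then lim_{σ→∞} [ Σ_{j,k∈{1,2}} x_j·x_k·Γ(τ,σ)_{j,k}·Λ(σ)_{k,j₀} − (Σ_j x_j·Λ(σ+τ)_{j,j₀})·(Σ_k x_k·Λ(σ)_{k,j₀}) ] = (x₁−x₂)²·(k(1−k) if j₀=1, r(1−r) if j₀=2), a value independent of τ (perfect temporal correlation), in contrast with the exponential decay of the true correlation function. -/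
open Filter

/-- The intermediate stochastic matrix `Γ(τ,σ)`. -/
noncomputable def Gam (k r α τ σ : ℝ) : Matrix (Fin 2) (Fin 2) ℝ :=
  !![1 - (1 - k) * Real.exp (-α * σ) * (1 - Real.exp (-α * τ)) / (Lam k r α σ).det,
     (1 - r) * Real.exp (-α * σ) * (1 - Real.exp (-α * τ)) / (Lam k r α σ).det;
     (1 - k) * Real.exp (-α * σ) * (1 - Real.exp (-α * τ)) / (Lam k r α σ).det,
     1 - (1 - r) * Real.exp (-α * σ) * (1 - Real.exp (-α * τ)) / (Lam k r α σ).det]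

/-- The transition matrix at infinite time. -/
def stationaryLam (k r : ℝ) : Matrix (Fin 2) (Fin 2) ℝ :=
  !![k, 1 - r; 1 - k, r]

lemma tendsto_exp_neg_mul_atTop {α : ℝ} (hα : 0 < α) :
    Tendsto (fun σ : ℝ => Real.exp (-α * σ)) atTop (nhds 0) :=
  Real.tendsto_exp_atBot.comp (tendsto_id.const_mul_atTop_of_neg (neg_neg_of_pos hα))

lemma tendsto_Lam (k r : ℝ) {α : ℝ} (hα : 0 < α) :
    Tendsto (Lam k r α) atTop (nhds (stationaryLam k r)) := by
  have hexp := tendsto_exp_neg_mul_atTop hα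
  refine tendsto_pi_nhds.2 fun i => tendsto_pi_nhds.2 fun j => ?_
  fin_cases i <;> fin_cases j
  · simpa [Lam, stationaryLam] using (hexp.const_mul (1 - k)).const_add k
  · simpa [Lam, stationaryLam] using (hexp.const_sub 1).const_mul (1 - r)
  · simpa [Lam, stationaryLam] using (hexp.const_sub 1).const_mul (1 - k)
  · simpa [Lam, stationaryLam] using (hexp.const_mul (1 - r)).const_add r

lemma det_stationaryLam (k r : ℝ) : (stationaryLam k r).det = k + r - 1 := by
  rw [stationaryLam, Matrix.det_fin_two_of]
  ring

lemma tendsto_Gam {k r α : ℝ} (hα : 0 < α) (hkr : k + r ≠ 1) (τ : ℝ) :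
    Tendsto (Gam k r α τ) atTop (nhds 1) := by
  have hdet : Tendsto (fun σ => (Lam k r α σ).det) atTop (nhds (k + r - 1)) := by
    rw [← det_stationaryLam]
    exact (continuous_id.matrix_det.tendsto _).comp (tendsto_Lam k r hα)
  have hquot (c : ℝ) : Tendsto (fun σ => c * Real.exp (-α * σ) * (1 - Real.exp (-α * τ)) /
      (Lam k r α σ).det) atTop (nhds 0) := by
    simpa [Pi.div_def] using (((tendsto_exp_neg_mul_atTop hα).const_mul c).mul_const
      (1 - Real.exp (-α * τ))).div hdet (sub_ne_zero.mpr hkr)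
  refine tendsto_pi_nhds.2 fun i => tendsto_pi_nhds.2 fun j => ?_
  fin_cases i <;> fin_cases j
  · simpa [Gam] using (hquot (1 - k)).const_sub 1
  · simpa [Gam] using hquot (1 - r)
  · simpa [Gam] using hquot (1 - k)
  · simpa [Gam] using (hquot (1 - r)).const_sub 1

/-- If the one-point memory matrix is replaced by `Γ(τ,σ)` in the two-time
correlation, the stationary limit equals the stationary conditional variance,
a value independent of the time difference `τ` (perfect temporal correlation),
in contrast with the exponential decay of the true correlation function. -/
theorem correlation_with_Gamma_is_constant (k r α : ℝ) (hk0 : 0 ≤ k) (hk1 : k ≤ 1)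
    (hr0 : 0 ≤ r) (hr1 : r ≤ 1) (hα : 0 < α) (hkr : 1 < k + r)
    (x₁ x₂ : ℝ) (j₀ : Fin 2) (τ : ℝ) (hτ : 0 < τ) :
    Tendsto (fun σ =>
        (∑ j : Fin 2, ∑ l : Fin 2,
            ![x₁, x₂] j * ![x₁, x₂] l * Gam k r α τ σ j l * Lam k r α σ l j₀) -
          (∑ j : Fin 2, ![x₁, x₂] j * Lam k r α (σ + τ) j j₀) *
            (∑ l : Fin 2, ![x₁, x₂] l * Lam k r α σ l j₀)) atTop
      (nhds ((x₁ - x₂) ^ 2 *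
        (if j₀ = 0 then k * (1 - k) else r * (1 - r)))) := by
  have hL (i j : Fin 2) := ((tendsto_Lam k r hα).apply_nhds i).apply_nhds j
  have hG (i j : Fin 2) := ((tendsto_Gam hα hkr.ne' τ).apply_nhds i).apply_nhds j
  have hLτ (i j : Fin 2) := (hL i j).comp (tendsto_atTop_add_const_right atTop τ tendsto_id)
  have hlim := (tendsto_finsetSum Finset.univ fun j _ => tendsto_finsetSum Finset.univ fun l _ =>
      ((hG j l).const_mul (![x₁, x₂] j * ![x₁, x₂] l)).mul (hL l j₀)).sub
    ((tendsto_finsetSum Finset.univ fun j _ => (hLτ j j₀).const_mul (![x₁, x₂] j)).mul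
      (tendsto_finsetSum Finset.univ fun l _ => (hL l j₀).const_mul (![x₁, x₂] l)))
  refine hlim.mono_right (congrArg nhds ?_).le
  fin_cases j₀ <;> simp [stationaryLam, Fin.sum_univ_two] <;> ring
end

section
/- Let x₁, x₂ be real numbers, q₁, q₂ ≥ 0 with q₁ + q₂ = 1, λ ≥ 0, and set m₂(σ) = x₁²·(Λ(σ)q)₁ + x₂²·(Λ(σ)q)₂, M₂ = (1−r)·x₁² + (1−k)·x₂², m₂⁰ = x₁²·q₁ + x₂²·q₂, and v₀ = m₂⁰ − (x₁·q₁ + x₂·q₂)². Then for all σ ≥ 0: m₂(σ) = M₂ + (k+r−1)·m₂⁰ + ( (2−k−r)·m₂⁰ − M₂ )·e^{−ασ}, and consequently the variance of the random walk satisfies, for every T ≥ 0: v₀ + λ·∫₀ᵀ m₂(σ) dσ = v₀ + λ·( M₂ + (k+r−1)·m₂⁰ )·T + λ·( (2−k−r)·m₂⁰ − M₂ )·(1 − e^{−αT})/α. -/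
open Matrix

/-- Second moment of the driving process at elapsed time `σ`:
`m₂(σ) = x₁²·(Λ(σ)q)₁ + x₂²·(Λ(σ)q)₂`. -/
noncomputable def secMom (k r α x₁ x₂ q₁ q₂ σ : ℝ) : ℝ :=
  x₁ ^ 2 * ((Lam k r α σ) *ᵥ ![q₁, q₂]) 0 +
    x₂ ^ 2 * ((Lam k r α σ) *ᵥ ![q₁, q₂]) 1

/-- Closed form of the second moment of the driving process. -/
theorem secMom_eq (k r α x₁ x₂ q₁ q₂ σ : ℝ) (hq : q₁ + q₂ = 1) :
    secMom k r α x₁ x₂ q₁ q₂ σ =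
      ((1 - r) * x₁ ^ 2 + (1 - k) * x₂ ^ 2) +
        (k + r - 1) * (x₁ ^ 2 * q₁ + x₂ ^ 2 * q₂) +
        ((2 - k - r) * (x₁ ^ 2 * q₁ + x₂ ^ 2 * q₂) -
          ((1 - r) * x₁ ^ 2 + (1 - k) * x₂ ^ 2)) * Real.exp (-α * σ) := by
  obtain rfl : q₂ = 1 - q₁ := by linarith
  simp only [secMom, Lam, Matrix.mulVec, dotProduct, Fin.sum_univ_two, Matrix.of_apply,
    Matrix.cons_val_zero, Matrix.cons_val_one]
  ring

/-- Integral of an affine function of a decaying exponential. -/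
theorem integral_const_add_const_mul_exp_neg_mul (a b T : ℝ) {α : ℝ} (hα : α ≠ 0) :
    ∫ σ in (0:ℝ)..T, (a + b * Real.exp (-α * σ)) =
      a * T + b * ((1 - Real.exp (-α * T)) / α) := by
  rw [intervalIntegral.integral_add intervalIntegrable_const
      (Continuous.intervalIntegrable (by fun_prop) _ _),
    intervalIntegral.integral_const, intervalIntegral.integral_const_mul,
    intervalIntegral.integral_comp_mul_left _ (neg_ne_zero.mpr hα), integral_exp]
  simp only [smul_eq_mul, mul_zero, Real.exp_zero, sub_zero]
  field_simp
  ring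

/-- Closed form of the second moment,
`m₂(σ) = M₂ + (k+r−1)·m₂⁰ + ((2−k−r)·m₂⁰ − M₂)·e^{−ασ}`, and the resulting
variance of the random walk driven by the Funessian process,
`σ(S(T)) = v₀ + λ·∫₀ᵀ m₂(σ) dσ
        = v₀ + λ·(M₂ + (k+r−1)·m₂⁰)·T + λ·((2−k−r)·m₂⁰ − M₂)·(1 − e^{−αT})/α`. -/
theorem random_walk_variance (k r α : ℝ) (hk0 : 0 ≤ k) (hk1 : k ≤ 1)
    (hr0 : 0 ≤ r) (hr1 : r ≤ 1) (hα : 0 < α)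
    (x₁ x₂ q₁ q₂ lam : ℝ) (hq1 : 0 ≤ q₁) (hq2 : 0 ≤ q₂) (hq : q₁ + q₂ = 1)
    (hlam : 0 ≤ lam) :
    (∀ σ : ℝ, 0 ≤ σ →
      secMom k r α x₁ x₂ q₁ q₂ σ =
        ((1 - r) * x₁ ^ 2 + (1 - k) * x₂ ^ 2) +
          (k + r - 1) * (x₁ ^ 2 * q₁ + x₂ ^ 2 * q₂) +
          ((2 - k - r) * (x₁ ^ 2 * q₁ + x₂ ^ 2 * q₂) -
            ((1 - r) * x₁ ^ 2 + (1 - k) * x₂ ^ 2)) * Real.exp (-α * σ)) ∧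
    (∀ T : ℝ, 0 ≤ T →
      (x₁ ^ 2 * q₁ + x₂ ^ 2 * q₂ - (x₁ * q₁ + x₂ * q₂) ^ 2) +
          lam * ∫ σ in (0:ℝ)..T, secMom k r α x₁ x₂ q₁ q₂ σ =
        (x₁ ^ 2 * q₁ + x₂ ^ 2 * q₂ - (x₁ * q₁ + x₂ * q₂) ^ 2) +
          lam * (((1 - r) * x₁ ^ 2 + (1 - k) * x₂ ^ 2) +
            (k + r - 1) * (x₁ ^ 2 * q₁ + x₂ ^ 2 * q₂)) * T +
          lam * ((2 - k - r) * (x₁ ^ 2 * q₁ + x₂ ^ 2 * q₂) -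
            ((1 - r) * x₁ ^ 2 + (1 - k) * x₂ ^ 2)) *
              ((1 - Real.exp (-α * T)) / α)) := by
  refine ⟨fun σ _ => secMom_eq k r α x₁ x₂ q₁ q₂ σ hq, fun T _ => ?_⟩
  simp only [secMom_eq k r α x₁ x₂ q₁ q₂ _ hq]
  rw [integral_const_add_const_mul_exp_neg_mul _ _ _ hα.ne']
  ring
end

section
/- Let x₁, x₂ be real numbers, q₁, q₂ ≥ 0 with q₁ + q₂ = 1, λ ≥ 0, and set m₂(σ) = x₁²·(Λ(σ)q)₁ + x₂²·(Λ(σ)q)₂, M₂ = (1−r)·x₁² + (1−k)·x₂², m₂⁰ = x₁²·q₁ + x₂²·q₂. Then the effective diffusion coefficient of the driven random walk, D_eff = lim_{T→∞} (1/2)·λ·m₂(T), exists and equals (λ/2)·( M₂ + (k+r−1)·m₂⁰ ); hence whenever k + r > 1 the long-time diffusion coefficient depends explicitly on the second moment m₂⁰ of the initial distribution, while for k + r = 1 it is independent of the initial preparation. -/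
open Filter Matrix

/-- The second moment converges to its value at the limit matrix of `Lam`. -/
theorem tendsto_secMom (k r : ℝ) {α : ℝ} (x₁ x₂ q₁ q₂ : ℝ) (hα : 0 < α) :
    Tendsto (secMom k r α x₁ x₂ q₁ q₂) atTop
      (nhds (x₁ ^ 2 * (k * q₁ + (1 - r) * q₂) + x₂ ^ 2 * ((1 - k) * q₁ + r * q₂))) := by
  have hexp : Tendsto (fun T : ℝ => Real.exp (-α * T)) atTop (nhds 0) :=
    Real.tendsto_exp_atBot.comp (tendsto_id.const_mul_atTop_of_neg (neg_lt_zero.mpr hα))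
  have hpoly : Continuous fun e : ℝ =>
      x₁ ^ 2 * ((k + (1 - k) * e) * q₁ + (1 - r) * (1 - e) * q₂) +
        x₂ ^ 2 * ((1 - k) * (1 - e) * q₁ + (r + (1 - r) * e) * q₂) := by
    fun_prop
  convert (hpoly.tendsto 0).comp hexp using 2
  · ext T
    simp [secMom, Lam, Matrix.mulVec, dotProduct, Fin.sum_univ_two]
  · ring

/-- The effective diffusion coefficient of the driven random walk,
`D_eff = lim_{T→∞} (1/2)·λ·m₂(T)`, exists and equals
`(λ/2)·(M₂ + (k+r−1)·m₂⁰)`: for `k + r > 1` it depends explicitly on the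
second moment `m₂⁰` of the initial distribution, while for `k + r = 1` it is
independent of the initial preparation. -/
theorem effective_diffusion_coefficient (k r α : ℝ) (hk0 : 0 ≤ k) (hk1 : k ≤ 1)
    (hr0 : 0 ≤ r) (hr1 : r ≤ 1) (hα : 0 < α)
    (x₁ x₂ q₁ q₂ lam : ℝ) (hq1 : 0 ≤ q₁) (hq2 : 0 ≤ q₂) (hq : q₁ + q₂ = 1)
    (hlam : 0 ≤ lam) :
    Tendsto (fun T => (1 / 2) * lam * secMom k r α x₁ x₂ q₁ q₂ T) atTop
      (nhds ((lam / 2) * (((1 - r) * x₁ ^ 2 + (1 - k) * x₂ ^ 2) +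
        (k + r - 1) * (x₁ ^ 2 * q₁ + x₂ ^ 2 * q₂)))) := by
  convert (tendsto_secMom k r x₁ x₂ q₁ q₂ hα).const_mul (1 / 2 * lam) using 2
  obtain rfl : q₂ = 1 - q₁ := by linarith
  ring
end
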